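/- arXiv:2406.05830 — 4 statements merged into one kernel-verified Lean document; each statement's English description precedes it below -/
import Mathlib

section
/- Let S be a finite index set with strictly positive real weights (w_i)_{i∈S}, let A ⊆ S with |A| ≥ 2, let i, j ∈ A with i ≠ j, and let k be an integer with 1 ≤ k ≤ |A| − 1. Then R(k−1, A∖{i}) · R(k−1, A∖{j}) > R(k−2, A∖{i, j}) · R(k, A). Equivalently, the inclusion probabilities satisfy π_i · π_j > π_{i,j}. -/
open Finset

/-- The R-function: `R(k, A) = ∑_{B ⊆ A, |B| = k} ∏_{i ∈ B} w i`, with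
`R(0, A) = 1` and `R(k, A) = 0` for `k < 0` or `k > |A|`. -/
noncomputable def Rfun {ι : Type*} [DecidableEq ι] (w : ι → ℝ) (k : ℤ) (A : Finset ι) : ℝ :=
  if k < 0 then 0 else ∑ B ∈ A.powersetCard k.toNat, ∏ i ∈ B, w i

theorem Rfun_eq_zero {ι : Type*} [DecidableEq ι] (w : ι → ℝ) {k : ℤ} {A : Finset ι}
    (hk : k < 0 ∨ (A.card : ℤ) < k) : Rfun w k A = 0 := by
  unfold Rfun
  split_ifs with h
  · rfl
  · rw [powersetCard_eq_empty.2 (by omega), sum_empty]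

theorem Rfun_pos {ι : Type*} [DecidableEq ι] {w : ι → ℝ} (hw : ∀ i, 0 < w i) {k : ℤ}
    {A : Finset ι} (hk0 : 0 ≤ k) (hk : k ≤ A.card) : 0 < Rfun w k A := by
  unfold Rfun
  rw [if_neg (not_lt.2 hk0)]
  exact sum_pos (fun B _ => prod_pos fun i _ => hw i) (powersetCard_nonempty.2 (by omega))

theorem Rfun_nonneg {ι : Type*} [DecidableEq ι] {w : ι → ℝ} (hw : ∀ i, 0 < w i) (k : ℤ)
    (A : Finset ι) : 0 ≤ Rfun w k A := by
  by_cases h : k < 0 ∨ (A.card : ℤ) < k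
  · exact (Rfun_eq_zero w h).ge
  · exact (Rfun_pos hw (by omega) (by omega)).le

theorem Rfun_insert {ι : Type*} [DecidableEq ι] (w : ι → ℝ) (k : ℤ) {a : ι} {A : Finset ι}
    (ha : a ∉ A) : Rfun w k (insert a A) = Rfun w k A + w a * Rfun w (k - 1) A := by
  rcases lt_trichotomy k 0 with hk | rfl | hk
  · simp [Rfun_eq_zero w (Or.inl hk), Rfun_eq_zero w (Or.inl (show k - 1 < 0 by omega))]
  · simp [Rfun]
  · obtain ⟨n, rfl⟩ : ∃ n : ℕ, k = n + 1 := ⟨(k - 1).toNat, by omega⟩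
    have h1 : ¬ ((n : ℤ) + 1 < 0) := by omega
    have h2 : ¬ ((n : ℤ) < 0) := by omega
    have h3 : ((n : ℤ) + 1).toNat = n + 1 := by omega
    have h_mem : ∀ B ∈ powersetCard n A, a ∉ B := fun B hB h =>
      ha ((mem_powersetCard.1 hB).1 h)
    simp only [Rfun, add_sub_cancel_right, h1, h2, h3, if_false, Int.toNat_natCast]
    rw [powersetCard_succ_insert ha, sum_union, sum_image, mul_sum]
    · congr 1
      exact sum_congr rfl fun B hB => prod_insert (h_mem B hB)
    · intro B hB C hC h
      rw [← erase_insert (h_mem B hB), ← erase_insert (h_mem C hC)]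
      exact congrArg (fun D => D.erase a) h
    · rw [disjoint_left]
      intro B hB hB'
      obtain ⟨C, -, rfl⟩ := mem_image.1 hB'
      exact ha ((mem_powersetCard.1 hB).1 (mem_insert_self a C))

/-- Strict log-concavity of the R-function in its order. -/
theorem Rfun_mul_lt_sq {ι : Type*} [DecidableEq ι] {w : ι → ℝ} (hw : ∀ i, 0 < w i)
    (A : Finset ι) (m : ℤ) (hm0 : 0 ≤ m) (hm : m ≤ A.card) :
    Rfun w (m - 1) A * Rfun w (m + 1) A < Rfun w m A ^ 2 := by
  induction A using Finset.induction_on generalizing m with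
  | empty =>
    rw [card_empty] at hm
    rw [Rfun_eq_zero w (Or.inl (show m - 1 < 0 by simp at hm; omega)), zero_mul]
    exact pow_pos (Rfun_pos hw hm0 (by simpa using hm)) 2
  | insert a A ha ih =>
    rw [card_insert_of_notMem ha] at hm
    push_cast at hm
    have weak : ∀ n : ℤ, Rfun w (n - 1) A * Rfun w (n + 1) A ≤ Rfun w n A ^ 2 := by
      intro n
      by_cases h : 0 ≤ n ∧ n ≤ A.card
      · exact (ih n h.1 h.2).le
      · refine le_trans (le_of_eq ?_) (sq_nonneg _)
        by_cases h0 : n < 0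
        · rw [Rfun_eq_zero w (Or.inl (show n - 1 < 0 by omega)), zero_mul]
        · rw [Rfun_eq_zero w (Or.inr (show (A.card : ℤ) < n + 1 by omega)), mul_zero]
    have h1 := weak m
    have h2 := weak (m - 1)
    rw [sub_add_cancel] at h2
    have cross : Rfun w (m - 1 - 1) A * Rfun w (m + 1) A ≤ Rfun w m A * Rfun w (m - 1) A := by
      by_cases h : 1 ≤ m ∧ m ≤ A.card
      · have p1 := Rfun_pos hw hm0 h.2
        have p2 := Rfun_pos hw (show 0 ≤ m - 1 by omega) (show m - 1 ≤ A.card by omega)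
        have key := mul_le_mul h1 h2
          (mul_nonneg (Rfun_nonneg hw _ _) (Rfun_nonneg hw _ _)) (sq_nonneg _)
        refine le_of_mul_le_mul_left ?_ (mul_pos p1 p2)
        linarith
      · refine le_trans (le_of_eq ?_) (mul_nonneg (Rfun_nonneg hw _ _) (Rfun_nonneg hw _ _))
        by_cases h0 : m < 1
        · rw [Rfun_eq_zero w (Or.inl (show m - 1 - 1 < 0 by omega)), zero_mul]
        · rw [Rfun_eq_zero w (Or.inr (show (A.card : ℤ) < m + 1 by omega)), mul_zero]
    rw [Rfun_insert w _ ha, Rfun_insert w _ ha, Rfun_insert w _ ha, add_sub_cancel_right]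
    have hx := hw a
    have hx2 := pow_pos hx 2
    have c' := mul_le_mul_of_nonneg_left cross hx.le
    rcases le_or_gt m A.card with h | h
    · have s1 := ih m hm0 h
      have t2 := mul_le_mul_of_nonneg_left h2 hx2.le
      linarith
    · have s2 := ih (m - 1) (by omega) (by omega)
      rw [sub_add_cancel] at s2
      have t2 := mul_lt_mul_of_pos_left s2 hx2
      linarith

/-- for strictly positive weights, `|A| ≥ 2`, distinct `i, j ∈ A`, and
`1 ≤ k ≤ |A| − 1`, one has `R(k−1, A∖{i}) R(k−1, A∖{j}) > R(k−2, A∖{i,j}) R(k, A)`;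
equivalently, the inclusion probabilities satisfy `π_i π_j > π_{i,j}`. -/
theorem stmt_5 {ι : Type*} [DecidableEq ι] (w : ι → ℝ) (hw : ∀ i, 0 < w i)
    (A : Finset ι) (hA : 2 ≤ A.card) (i j : ι) (hi : i ∈ A) (hj : j ∈ A) (hij : i ≠ j)
    (k : ℤ) (hk1 : 1 ≤ k) (hk2 : k ≤ (A.card : ℤ) - 1) :
    Rfun w (k - 1) (A.erase i) * Rfun w (k - 1) (A.erase j) >
      Rfun w (k - 2) ((A.erase i).erase j) * Rfun w k A ∧
    (w i * Rfun w (k - 1) (A.erase i) / Rfun w k A) *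
        (w j * Rfun w (k - 1) (A.erase j) / Rfun w k A) >
      w i * w j * Rfun w (k - 2) ((A.erase i).erase j) / Rfun w k A := by
  have hji : j ∈ A.erase i := mem_erase.2 ⟨hij.symm, hj⟩
  set C := (A.erase i).erase j with hC
  have hjC : j ∉ C := notMem_erase j _
  have hiC : i ∉ C := fun h => notMem_erase i A (mem_of_mem_erase h)
  have hAi : A.erase i = insert j C := (insert_erase hji).symm
  have hAj : A.erase j = insert i C := by
    rw [hC, erase_right_comm, insert_erase (mem_erase.2 ⟨hij, hi⟩)]
  have hiAi : i ∉ insert j C := hAi ▸ notMem_erase i A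
  have hA' : A = insert i (insert j C) := by rw [← hAi, insert_erase hi]
  have hcard : A.card = C.card + 2 := by
    rw [hA', card_insert_of_notMem hiAi, card_insert_of_notMem hjC]
  have main : Rfun w (k - 2) C * Rfun w k A <
      Rfun w (k - 1) (A.erase i) * Rfun w (k - 1) (A.erase j) := by
    have h := Rfun_mul_lt_sq hw C (k - 1) (by omega) (by omega)
    have e : k - 1 - 1 = k - 2 := by ring
    rw [sub_add_cancel, e] at h
    rw [hAi, hAj, hA']
    simp only [Rfun_insert w _ hiAi, Rfun_insert w _ hjC, Rfun_insert w _ hiC, e]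
    linarith
  refine ⟨main, ?_⟩
  have hR : 0 < Rfun w k A := Rfun_pos hw (by omega) (by omega)
  rw [gt_iff_lt, div_mul_div_comm, div_lt_div_iff₀ hR (mul_pos hR hR)]
  have h := mul_lt_mul_of_pos_left main (mul_pos (mul_pos (hw i) (hw j)) hR)
  linarith
end

section
/- Let S be a finite index set with real weights (w_i)_{i∈S}, let z be an integer, and let i ∈ S. Then ∑_{d ∈ {0,1}^S, ∑_k d_k = z} d_i · ∏_{j ∈ S} w_j^{d_j} = w_i · R(z−1, S∖{i}). In particular, for strictly positive weights and 0 ≤ z ≤ |S|, the conditional expectation of the i-th entry under the conditional Bernoulli model equals the first-order inclusion probability: E[d_i | ∑_k d_k = z] = π_i. -/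
open Finset

/-- The R-function as a sum over all subsets with prescribed integer cardinality. -/
theorem Rfun_eq_sum_filter {ι : Type*} [DecidableEq ι] (w : ι → ℝ) (k : ℤ) (A : Finset ι) :
    Rfun w k A = ∑ B ∈ A.powerset.filter (fun B => (B.card : ℤ) = k), ∏ j ∈ B, w j := by
  unfold Rfun
  split_ifs with hk
  · rw [Finset.filter_false_of_mem, Finset.sum_empty]
    intro B _
    omega
  · congr 1
    ext B
    simp only [Finset.mem_powersetCard, Finset.mem_filter, Finset.mem_powerset]
    constructor <;> rintro ⟨h, hc⟩ <;> exact ⟨h, by omega⟩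

theorem sum_fin_two_eq_card {ι : Type*} [Fintype ι] (d : ι → Fin 2) :
    (∑ k, ((d k : ℕ) : ℤ)) = ((Finset.univ.filter (fun k => d k = 1)).card : ℤ) := by
  rw [Finset.card_filter]
  push_cast
  refine Finset.sum_congr rfl fun k _ => ?_
  generalize d k = x
  fin_cases x <;> simp

theorem prod_pow_fin_two_eq {ι : Type*} [Fintype ι] (w : ι → ℝ) (d : ι → Fin 2) :
    ∏ j, w j ^ (d j : ℕ) = ∏ j ∈ Finset.univ.filter (fun k => d k = 1), w j := by
  rw [Finset.prod_filter]
  refine Finset.prod_congr rfl fun k _ => ?_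
  generalize d k = x
  fin_cases x <;> simp

theorem filter_indicator_eq_one {ι : Type*} [Fintype ι] [DecidableEq ι] (B : Finset ι) :
    Finset.univ.filter (fun k => (if k ∈ B then (1 : Fin 2) else 0) = 1) = B := by
  ext k
  simp

theorem sum_entry_mul_prod_eq {ι : Type*} [Fintype ι] [DecidableEq ι]
    (w : ι → ℝ) (z : ℤ) (i : ι) :
    (∑ d ∈ Finset.univ.filter (fun d : ι → Fin 2 => (∑ k, ((d k : ℕ) : ℤ)) = z),
        ((d i : ℕ) : ℝ) * (∏ j, w j ^ (d j : ℕ)))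
      = w i * Rfun w (z - 1) (Finset.univ.erase i) := by
  have hentry : ∀ d : ι → Fin 2, ((d i : ℕ) : ℝ) * (∏ j, w j ^ (d j : ℕ))
      = if d i = 1 then ∏ j ∈ Finset.univ.filter (fun k => d k = 1), w j else 0 := by
    intro d
    rw [prod_pow_fin_two_eq]
    generalize d i = x
    fin_cases x <;> simp
  simp only [hentry, sum_fin_two_eq_card]
  rw [← Finset.sum_filter, Finset.filter_filter, Rfun_eq_sum_filter, Finset.mul_sum]
  refine Finset.sum_nbij' (fun d => (Finset.univ.filter (fun k => d k = 1)).erase i)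
    (fun B j => if j ∈ insert i B then 1 else 0) ?_ ?_ ?_ ?_ ?_
  · intro d hd
    simp only [Finset.mem_filter, Finset.mem_univ, true_and] at hd
    have hi : i ∈ Finset.univ.filter (fun k => d k = 1) := by simp [hd.2]
    have hcard := Finset.card_erase_add_one hi
    simp only [Finset.mem_filter, Finset.mem_powerset]
    exact ⟨Finset.erase_subset_erase _ (Finset.subset_univ _), by omega⟩
  · intro B hB
    simp only [Finset.mem_filter, Finset.mem_powerset] at hB
    have hi : i ∉ B := fun h => by simpa using hB.1 h
    have hcard := Finset.card_insert_of_notMem hi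
    simp only [Finset.mem_filter, Finset.mem_univ, true_and, filter_indicator_eq_one]
    exact ⟨by omega, by simp⟩
  · intro d hd
    simp only [Finset.mem_filter, Finset.mem_univ, true_and] at hd
    have hi : i ∈ Finset.univ.filter (fun k => d k = 1) := by simp [hd.2]
    funext j
    simp only [Finset.insert_erase hi, Finset.mem_filter, Finset.mem_univ, true_and]
    generalize d j = x
    fin_cases x <;> simp
  · intro B hB
    simp only [Finset.mem_filter, Finset.mem_powerset] at hB
    have hi : i ∉ B := fun h => by simpa using hB.1 h
    simp only [filter_indicator_eq_one, Finset.erase_insert hi]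
  · intro d hd
    simp only [Finset.mem_filter, Finset.mem_univ, true_and] at hd
    exact (Finset.mul_prod_erase _ w (by simp [hd.2])).symm

/-- `∑_{d ∈ {0,1}^S, ∑ d = z} d_i ∏_j w_j^{d_j} = w_i R(z−1, S∖{i})`;
in particular, for strictly positive weights and `0 ≤ z ≤ |S|`, the conditional expectation
of the `i`-th entry under the conditional Bernoulli model equals the first-order inclusion
probability: `E[d_i | ∑ d = z] = π_i`. -/
theorem stmt_13 {ι : Type*} [Fintype ι] [DecidableEq ι] (w : ι → ℝ) (z : ℤ) (i : ι) :
    (∑ d ∈ Finset.univ.filter (fun d : ι → Fin 2 => (∑ k, ((d k : ℕ) : ℤ)) = z),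
        ((d i : ℕ) : ℝ) * (∏ j, w j ^ (d j : ℕ)))
      = w i * Rfun w (z - 1) (Finset.univ.erase i) ∧
    ((∀ j, 0 < w j) → 0 ≤ z → z ≤ (Fintype.card ι : ℤ) →
      (∑ d ∈ Finset.univ.filter (fun d : ι → Fin 2 => (∑ k, ((d k : ℕ) : ℤ)) = z),
          ((∏ j, w j ^ (d j : ℕ)) / Rfun w z Finset.univ) * ((d i : ℕ) : ℝ))
        = w i * Rfun w (z - 1) (Finset.univ.erase i) / Rfun w z Finset.univ) := by
  refine ⟨sum_entry_mul_prod_eq w z i, fun _ _ _ => ?_⟩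
  rw [← sum_entry_mul_prod_eq, Finset.sum_div]
  exact Finset.sum_congr rfl fun d _ => by ring
end

section
/- Let N ≥ 1, S = {1,…,N}, p ∈ (0,1)^N with weights w_i = p_i/(1−p_i), and let z be an integer with 0 ≤ z ≤ N. Then the total variance of the score (the gradient of the log conditional Bernoulli PMF) satisfies ∑_{d ∈ {0,1}^N, ∑_k d_k = z} P(d | z; p) · ∑_{i=1}^N ((1+w_i)²/w_i)² (d_i − π_i)² = ∑_{i=1}^N ((1+w_i)⁴/w_i²) (π_i − π_i²), where P(d | z; p) = (∏_i w_i^{d_i})/R(z, S) and π_i = w_i R(z−1, S∖{i})/R(z, S). -/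
open Finset

/-- Bernoulli weights `w_j = p_j / (1 − p_j)`. -/
noncomputable def wOf {N : ℕ} (p : Fin N → ℝ) : Fin N → ℝ := fun j => p j / (1 - p j)

/-- First-order inclusion probability `π_i = w_i R(z−1, S∖{i}) / R(z, S)`. -/
noncomputable def piOf {N : ℕ} (p : Fin N → ℝ) (z : ℕ) (i : Fin N) : ℝ :=
  wOf p i * Rfun (wOf p) ((z : ℤ) - 1) (Finset.univ.erase i) / Rfun (wOf p) (z : ℤ) Finset.univ

/-- The conditional Bernoulli PMF `P(d | z; p) = (∏_i w_i^{d_i}) / R(z, S)`. -/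
noncomputable def cbP {N : ℕ} (p : Fin N → ℝ) (z : ℕ) (d : Fin N → Fin 2) : ℝ :=
  (∏ i, wOf p i ^ (d i : ℕ)) / Rfun (wOf p) (z : ℤ) Finset.univ

theorem sum_configurations_eq_sum_powersetCard {ι M : Type*} [Fintype ι] [DecidableEq ι]
    [AddCommMonoid M] (z : ℕ) (f : (ι → Fin 2) → M) :
    ∑ d ∈ univ.filter (fun d : ι → Fin 2 => (∑ k, (d k : ℕ)) = z), f d
      = ∑ B ∈ (univ : Finset ι).powersetCard z, f (fun i => if i ∈ B then 1 else 0) := by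
  have val (x : Fin 2) : (x : ℕ) = if x = 1 then 1 else 0 := by
    fin_cases x <;> rfl
  have left_inv (d : ι → Fin 2) :
      (fun i => if i ∈ univ.filter (fun j => d j = 1) then (1 : Fin 2) else 0) = d := by
    funext i
    by_cases h : d i = 1
    · simp [h]
    · simp only [mem_filter, mem_univ, true_and, h, if_false]
      omega
  refine sum_bij' (fun d _ => univ.filter (fun i => d i = 1))
    (fun B _ i => if i ∈ B then 1 else 0) ?_ ?_ ?_ ?_ ?_
  · intro d hd
    rw [mem_filter] at hd
    rw [mem_powersetCard]
    refine ⟨subset_univ _, ?_⟩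
    rw [card_filter, ← hd.2]
    exact sum_congr rfl fun i _ => (val (d i)).symm
  · intro B hB
    rw [mem_powersetCard] at hB
    simp [val, hB.2]
  · intro d _
    exact left_inv d
  · intro B _
    ext i
    simp
  · intro d _
    rw [left_inv d]

theorem Rfun_natCast {ι : Type*} [DecidableEq ι] (w : ι → ℝ) (k : ℕ) (A : Finset ι) :
    Rfun w k A = ∑ B ∈ A.powersetCard k, ∏ i ∈ B, w i := by
  simp [Rfun]

theorem Rfun_natCast_pos {ι : Type*} [DecidableEq ι] {w : ι → ℝ} {k : ℕ} {A : Finset ι}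
    (hw : ∀ i ∈ A, 0 < w i) (hk : k ≤ #A) : 0 < Rfun w k A := by
  rw [Rfun_natCast]
  refine sum_pos (fun B hB => prod_pos fun i hi => hw i ((mem_powersetCard.1 hB).1 hi)) ?_
  exact powersetCard_nonempty.2 hk

theorem sum_powersetCard_filter_mem {ι : Type*} [DecidableEq ι] (w : ι → ℝ) (k : ℕ)
    {A : Finset ι} {i : ι} (hi : i ∈ A) :
    ∑ B ∈ (A.powersetCard k).filter (fun B => i ∈ B), ∏ j ∈ B, w j
      = w i * Rfun w ((k : ℤ) - 1) (A.erase i) := by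
  cases k with
  | zero => simp [Rfun, filter_singleton]
  | succ k =>
    have hcast : ((k + 1 : ℕ) : ℤ) - 1 = (k : ℤ) := by push_cast; ring
    rw [hcast, Rfun_natCast, mul_sum]
    refine sum_bij' (fun B _ => B.erase i) (fun B _ => insert i B) ?_ ?_ ?_ ?_ ?_
    · intro B hB
      rw [mem_filter, mem_powersetCard] at hB
      rw [mem_powersetCard, card_erase_of_mem hB.2, hB.1.2]
      exact ⟨erase_subset_erase i hB.1.1, rfl⟩
    · intro B hB
      rw [mem_powersetCard, subset_erase] at hB
      rw [mem_filter, mem_powersetCard, card_insert_of_notMem hB.1.2, hB.2]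
      exact ⟨⟨insert_subset hi hB.1.1, rfl⟩, mem_insert_self i B⟩
    · intro B hB
      exact insert_erase (mem_filter.1 hB).2
    · intro B hB
      rw [mem_powersetCard, subset_erase] at hB
      exact erase_insert hB.1.2
    · intro B hB
      exact (mul_prod_erase B w (mem_filter.1 hB).2).symm

theorem sum_cbP {N : ℕ} (p : Fin N → ℝ) (z : ℕ) (hR : Rfun (wOf p) (z : ℤ) univ ≠ 0) :
    ∑ d ∈ univ.filter (fun d : Fin N → Fin 2 => (∑ k, (d k : ℕ)) = z), cbP p z d = 1 := by
  rw [sum_configurations_eq_sum_powersetCard]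
  simp only [cbP]
  rw [← sum_div, div_eq_one_iff_eq hR, Rfun_natCast]
  refine sum_congr rfl fun B _ => ?_
  simp [apply_ite Fin.val, pow_ite, prod_ite_mem]

theorem sum_cbP_mul_coord {N : ℕ} (p : Fin N → ℝ) (z : ℕ) (i : Fin N) :
    ∑ d ∈ univ.filter (fun d : Fin N → Fin 2 => (∑ k, (d k : ℕ)) = z),
      cbP p z d * ((d i : ℕ) : ℝ) = piOf p z i := by
  rw [sum_configurations_eq_sum_powersetCard, piOf,
    ← sum_powersetCard_filter_mem (wOf p) z (mem_univ i), sum_filter, sum_div]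
  refine sum_congr rfl fun B _ => ?_
  by_cases h : i ∈ B <;> simp [cbP, h, apply_ite Fin.val, pow_ite, prod_ite_mem]

theorem sum_cbP_mul_sq_sub {N : ℕ} (p : Fin N → ℝ) (z : ℕ) (i : Fin N)
    (hR : Rfun (wOf p) (z : ℤ) univ ≠ 0) :
    ∑ d ∈ univ.filter (fun d : Fin N → Fin 2 => (∑ k, (d k : ℕ)) = z),
      cbP p z d * (((d i : ℕ) : ℝ) - piOf p z i) ^ 2 = piOf p z i - piOf p z i ^ 2 := by
  have expand (d : Fin N → Fin 2) : cbP p z d * (((d i : ℕ) : ℝ) - piOf p z i) ^ 2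
      = (1 - 2 * piOf p z i) * (cbP p z d * ((d i : ℕ) : ℝ)) + piOf p z i ^ 2 * cbP p z d := by
    have hsq : (((d i : ℕ) : ℝ)) ^ 2 = ((d i : ℕ) : ℝ) := by
      generalize d i = x
      fin_cases x <;> simp
    linear_combination cbP p z d * hsq
  simp only [expand]
  rw [sum_add_distrib, ← mul_sum, ← mul_sum, sum_cbP_mul_coord, sum_cbP p z hR]
  ring

/-- the total variance of the score of the conditional Bernoulli model:
`∑_{d : ∑ d = z} P(d|z;p) ∑_i ((1+w_i)²/w_i)² (d_i − π_i)²
 = ∑_i ((1+w_i)⁴/w_i²)(π_i − π_i²)`. -/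
theorem stmt_15 (N : ℕ) (hN : 1 ≤ N) (p : Fin N → ℝ) (hp : ∀ i, p i ∈ Set.Ioo (0 : ℝ) 1)
    (z : ℕ) (hz : z ≤ N) :
    (∑ d ∈ Finset.univ.filter (fun d : Fin N → Fin 2 => (∑ k, (d k : ℕ)) = z),
        cbP p z d * (∑ i, ((1 + wOf p i) ^ 2 / wOf p i) ^ 2 *
          (((d i : ℕ) : ℝ) - piOf p z i) ^ 2))
      = ∑ i, (1 + wOf p i) ^ 4 / (wOf p i) ^ 2 * (piOf p z i - (piOf p z i) ^ 2) := by
  have hw (i : Fin N) : 0 < wOf p i := div_pos (hp i).1 (sub_pos.2 (hp i).2)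
  have hR : Rfun (wOf p) (z : ℤ) univ ≠ 0 :=
    (Rfun_natCast_pos (fun i _ => hw i) (by simpa using hz)).ne'
  simp only [mul_sum]
  rw [sum_comm]
  refine sum_congr rfl fun i _ => ?_
  simp only [mul_left_comm (cbP p z _)]
  rw [← mul_sum, sum_cbP_mul_sq_sub p z i hR]
  ring
end

section
/- Let N ≥ 1, S = {1,…,N}, let z be an integer with 0 ≤ z ≤ N, let D = {d ∈ {0,1}^N : ∑_i d_i = z}, and let f : {0,1}^N → ℝ with M = max_{d ∈ D} |f(d)|. For p ∈ (0,1)^N with weights w_i = p_i/(1−p_i), define the stochastic objective Ψ(p) = ∑_{d ∈ D} f(d) · (∏_i w_i^{d_i}) / R(z, S), and set C = max_{i=1,…,N} (1+w_i)²/w_i. Then the Euclidean norm of the gradient of Ψ at p satisfies ‖∇_p Ψ(p)‖ ≤ M · C(N, z) · √N · C, where C(N, z) denotes the binomial coefficient N choose z (the cardinality of D). -/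
open Finset

/-- The stochastic objective `Ψ(p) = ∑_{d : ∑ d = z} f(d) (∏_i w_i^{d_i}) / R(z, S)`,
the expectation of `f` under the conditional Bernoulli model with weights
`w_i = p_i/(1−p_i)`. -/
noncomputable def Psi (N : ℕ) (z : ℕ) (f : (Fin N → Fin 2) → ℝ) (q : Fin N → ℝ) : ℝ :=
  ∑ d ∈ Finset.univ.filter (fun d : Fin N → Fin 2 => (∑ i, (d i : ℕ)) = z),
    f d * ((∏ i, (q i / (1 - q i)) ^ (d i : ℕ)) /
      Rfun (fun j => q j / (1 - q j)) (z : ℤ) Finset.univ)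

/-- The unnormalised conditional Bernoulli weight `∏ j, w j ^ d j` with `w j = q j / (1 - q j)`. -/
noncomputable def bernoulliWeight {N : ℕ} (d : Fin N → Fin 2) (q : Fin N → ℝ) : ℝ :=
  ∏ j, (q j / (1 - q j)) ^ (d j : ℕ)

lemma bernoulliWeight_pos {N : ℕ} (d : Fin N → Fin 2) {q : Fin N → ℝ}
    (hq : ∀ i, q i ∈ Set.Ioo (0 : ℝ) 1) : 0 < bernoulliWeight d q :=
  prod_pos fun j _ => pow_pos (div_pos (hq j).1 (sub_pos.2 (hq j).2)) _

lemma Rfun_univ_eq_sum {N : ℕ} (w : Fin N → ℝ) (z : ℕ) :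
    Rfun w (z : ℤ) univ =
      ∑ d ∈ univ.filter (fun d : Fin N → Fin 2 => (∑ i, (d i : ℕ)) = z),
        ∏ j, w j ^ (d j : ℕ) := by
  have hval : ∀ x : Fin 2, (x : ℕ) = if x = 1 then 1 else 0 := by decide
  have hne : ∀ x : Fin 2, x ≠ 1 → 0 = x := by decide
  rw [Rfun, if_neg (by omega), Int.toNat_natCast]
  symm
  refine sum_nbij' (fun d => univ.filter fun j => d j = 1) (fun B j => if j ∈ B then 1 else 0)
    ?_ ?_ ?_ ?_ ?_
  · intro d hd
    simp only [mem_filter, mem_univ, true_and] at hd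
    simp only [mem_powersetCard, subset_univ, true_and, card_filter, ← hd, ← hval]
  · intro B hB
    simp only [mem_powersetCard, subset_univ, true_and] at hB
    simp [hval, hB]
  · intro d _
    funext j
    by_cases h : d j = 1
    · simp [h]
    · simpa [h] using hne _ h
  · intro B _
    ext j
    simp
  · intro d _
    rw [prod_filter]
    refine prod_congr rfl fun j _ => ?_
    rw [hval (d j)]
    split_ifs <;> simp

lemma hasDerivAt_odds_pow (n : ℕ) {x : ℝ} (hx : x ∈ Set.Ioo (0 : ℝ) 1) :
    HasDerivAt (fun t : ℝ => (t / (1 - t)) ^ n)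
      ((x / (1 - x)) ^ n * (n * ((1 + x / (1 - x)) ^ 2 / (x / (1 - x))))) x := by
  have h0 : x ≠ 0 := hx.1.ne'
  have h1 : 1 - x ≠ 0 := (sub_pos.2 hx.2).ne'
  have h := (((hasDerivAt_id x).div ((hasDerivAt_id x).const_sub 1) h1).pow n)
  refine h.congr_deriv ?_
  rcases n with _ | n
  · simp
  · simp only [id, Nat.add_sub_cancel, pow_succ, Pi.div_apply]
    field_simp
    ring

lemma hasDerivAt_bernoulliWeight {N : ℕ} (d : Fin N → Fin 2) {p : Fin N → ℝ} (i : Fin N)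
    (hp : p i ∈ Set.Ioo (0 : ℝ) 1) :
    HasDerivAt (fun t : ℝ => bernoulliWeight d (Function.update p i t))
      (bernoulliWeight d p *
        ((d i : ℕ) * ((1 + p i / (1 - p i)) ^ 2 / (p i / (1 - p i))))) (p i) := by
  have hsplit : ∀ t, bernoulliWeight d (Function.update p i t) =
      (t / (1 - t)) ^ (d i : ℕ) * ∏ j ∈ univ.erase i, (p j / (1 - p j)) ^ (d j : ℕ) := by
    intro t
    rw [bernoulliWeight, ← mul_prod_erase univ _ (mem_univ i), Function.update_self]
    congr 1
    refine prod_congr rfl fun j hj => ?_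
    rw [Function.update_of_ne (ne_of_mem_erase hj)]
  have hself := hsplit (p i)
  rw [Function.update_eq_self] at hself
  rw [funext hsplit, hself]
  exact ((hasDerivAt_odds_pow _ hp).mul_const _).congr_deriv (by ring)

/-- A partial derivative of a normalised weighted average whose weights have logarithmic
derivatives `a d * c` with `a d ∈ [0, 1]` is bounded by `M * c`. -/
lemma abs_deriv_weighted_average_le {α : Type*} {D : Finset α} (hD : D.Nonempty)
    {f a : α → ℝ} {W : α → ℝ → ℝ} {x M c : ℝ}
    (hf : ∀ d ∈ D, |f d| ≤ M) (ha : ∀ d, a d ∈ Set.Icc (0 : ℝ) 1) (hc : 0 ≤ c)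
    (hW : ∀ d, 0 < W d x) (hderiv : ∀ d, HasDerivAt (W d) (W d x * (a d * c)) x) :
    |deriv (fun t => ∑ d ∈ D, f d * (W d t / ∑ e ∈ D, W e t)) x| ≤ M * c := by
  set R := ∑ e ∈ D, W e x with hR
  have hRpos : 0 < R := sum_pos (fun e _ => hW e) hD
  set m := (∑ e ∈ D, W e x * a e) / R with hm
  have hm0 : 0 ≤ m := div_nonneg (sum_nonneg fun e _ => mul_nonneg (hW e).le (ha e).1) hRpos.le
  have hm1 : m ≤ 1 := (div_le_one hRpos).2
    (sum_le_sum fun e _ => mul_le_of_le_one_right (hW e).le (ha e).2)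
  have hRd : HasDerivAt (fun t => ∑ e ∈ D, W e t) (m * R * c) x := by
    refine (HasDerivAt.fun_sum fun e _ => hderiv e).congr_deriv ?_
    rw [hm, div_mul_cancel₀ _ hRpos.ne', sum_mul]
    exact sum_congr rfl fun e _ => by ring
  have hΨ : HasDerivAt (fun t => ∑ d ∈ D, f d * (W d t / ∑ e ∈ D, W e t))
      (∑ d ∈ D, f d * (W d x / R * ((a d - m) * c))) x := by
    refine HasDerivAt.fun_sum fun d _ => ?_
    refine (((hderiv d).fun_div hRd hRpos.ne').const_mul (f d)).congr_deriv ?_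
    rw [← hR]
    field_simp
  rw [hΨ.deriv]
  calc |∑ d ∈ D, f d * (W d x / R * ((a d - m) * c))|
      ≤ ∑ d ∈ D, |f d * (W d x / R * ((a d - m) * c))| := abs_sum_le_sum_abs _ _
    _ ≤ ∑ d ∈ D, M * (W d x / R * (1 * c)) := by
        refine sum_le_sum fun d hd => ?_
        have hP : 0 ≤ W d x / R := (div_pos (hW d) hRpos).le
        have ham : |a d - m| ≤ 1 := abs_le.2 ⟨by linarith [(ha d).1], by linarith [(ha d).2]⟩
        have hM : 0 ≤ M := (abs_nonneg _).trans (hf d hd)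
        rw [abs_mul, abs_mul, abs_mul, abs_of_nonneg hP, abs_of_nonneg hc]
        gcongr
        exact hf d hd
    _ = M * c := by
        rw [← mul_sum, ← sum_mul, ← sum_div, ← hR, div_self hRpos.ne']
        ring

/-- with `M = max_{d ∈ D} |f(d)|` and `C = max_i (1+w_i)²/w_i`, the
Euclidean norm of the gradient of the stochastic objective satisfies
`‖∇_p Ψ(p)‖ ≤ M ⋅ binom(N, z) ⋅ √N ⋅ C`. -/
theorem stmt_17 (N : ℕ) (hN : 1 ≤ N) (z : ℕ) (hz : z ≤ N)
    (f : (Fin N → Fin 2) → ℝ)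
    (hD : (Finset.univ.filter (fun d : Fin N → Fin 2 => (∑ i, (d i : ℕ)) = z)).Nonempty)
    (M : ℝ)
    (hM : M = (Finset.univ.filter (fun d : Fin N → Fin 2 => (∑ i, (d i : ℕ)) = z)).sup' hD
      (fun d => |f d|))
    (p : Fin N → ℝ) (hp : ∀ i, p i ∈ Set.Ioo (0 : ℝ) 1)
    (C : ℝ)
    (hC : C = Finset.univ.sup' ⟨⟨0, hN⟩, Finset.mem_univ _⟩
      (fun i : Fin N => (1 + p i / (1 - p i)) ^ 2 / (p i / (1 - p i)))) :
    Real.sqrt (∑ i, (deriv (fun t : ℝ => Psi N z f (Function.update p i t)) (p i)) ^ 2)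
      ≤ M * (N.choose z : ℝ) * Real.sqrt N * C := by
  have hΨ : ∀ q, Psi N z f q =
      ∑ d ∈ univ.filter (fun d : Fin N → Fin 2 => (∑ i, (d i : ℕ)) = z),
        f d * (bernoulliWeight d q /
          ∑ e ∈ univ.filter (fun d : Fin N → Fin 2 => (∑ i, (d i : ℕ)) = z),
            bernoulliWeight e q) := by
    intro q
    simp only [Psi, Rfun_univ_eq_sum, bernoulliWeight]
  have hfM : ∀ d ∈ univ.filter (fun d : Fin N → Fin 2 => (∑ i, (d i : ℕ)) = z), |f d| ≤ M := by
    intro d hd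
    rw [hM]
    exact le_sup' (fun d => |f d|) hd
  have hM0 : 0 ≤ M := hD.elim fun d hd => (abs_nonneg _).trans (hfM d hd)
  have hc0 : ∀ i, 0 ≤ (1 + p i / (1 - p i)) ^ 2 / (p i / (1 - p i)) := fun i =>
    div_nonneg (sq_nonneg _) (div_pos (hp i).1 (sub_pos.2 (hp i).2)).le
  have hcC : ∀ i, (1 + p i / (1 - p i)) ^ 2 / (p i / (1 - p i)) ≤ C := by
    intro i
    rw [hC]
    exact le_sup' (fun i : Fin N => (1 + p i / (1 - p i)) ^ 2 / (p i / (1 - p i))) (mem_univ i)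
  have hC0 : 0 ≤ C := (hc0 ⟨0, hN⟩).trans (hcC _)
  have hbound : ∀ i,
      |deriv (fun t : ℝ => Psi N z f (Function.update p i t)) (p i)| ≤ M * C := by
    intro i
    simp only [hΨ]
    refine (abs_deriv_weighted_average_le hD
      (W := fun d t => bernoulliWeight d (Function.update p i t))
      (a := fun d => ((d i : ℕ) : ℝ)) hfM ?_ (hc0 i) ?_ ?_).trans
      (mul_le_mul_of_nonneg_left (hcC i) hM0)
    · intro d
      exact ⟨Nat.cast_nonneg _, by exact_mod_cast Nat.lt_succ_iff.1 (d i).isLt⟩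
    · intro d
      simpa only [Function.update_eq_self] using bernoulliWeight_pos d hp
    · intro d
      simpa only [Function.update_eq_self] using hasDerivAt_bernoulliWeight d i (hp i)
  have hchoose : (1 : ℝ) ≤ N.choose z := by exact_mod_cast Nat.choose_pos hz
  calc Real.sqrt (∑ i, (deriv (fun t : ℝ => Psi N z f (Function.update p i t)) (p i)) ^ 2)
      ≤ Real.sqrt (∑ _i : Fin N, (M * C) ^ 2) := by
        refine Real.sqrt_le_sqrt (sum_le_sum fun i _ => ?_)
        exact sq_le_sq.2 ((hbound i).trans (le_abs_self _))
    _ = M * 1 * Real.sqrt N * C := by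
        rw [sum_const, card_univ, Fintype.card_fin, nsmul_eq_mul,
          Real.sqrt_mul (Nat.cast_nonneg N), Real.sqrt_sq (mul_nonneg hM0 hC0)]
        ring
    _ ≤ M * (N.choose z : ℝ) * Real.sqrt N * C := by gcongr
end
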